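/- Let G be a finite subgroup of U(2) generated by reflections, acting on S = ℂ[X,Y] by (g·f)(v) = f(g⁻¹v), with invariant ring R = S^G. Let 𝔪₀ be the ideal of R of invariants vanishing at 0, and F = S/S𝔪₀ the coinvariant algebra. Then F is finite-dimensional and is isomorphic as a representation of G to the regular representation ℂ[G] of G. -/

import Mathlib

open Matrix MvPolynomial

/-- The action of a unitary matrix `g` on polynomial functions on ℂ²:
`(g · f)(v) = f(g⁻¹ v)`. -/
noncomputable def actU2 (g : Matrix.unitaryGroup (Fin 2) ℂ) :
    MvPolynomial (Fin 2) ℂ →ₐ[ℂ] MvPolynomial (Fin 2) ℂ :=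
  MvPolynomial.aeval fun i =>
    ∑ j : Fin 2, MvPolynomial.C
      (((g⁻¹ : Matrix.unitaryGroup (Fin 2) ℂ) : Matrix (Fin 2) (Fin 2) ℂ) i j) *
        MvPolynomial.X j

/-- A reflection in U(2): an element of finite order, different from the identity,
fixing a one-dimensional subspace of ℂ² pointwise. -/
def IsReflectionU2 (g : Matrix.unitaryGroup (Fin 2) ℂ) : Prop :=
  g ≠ 1 ∧ IsOfFinOrder g ∧
    ∃ P : Submodule ℂ (Fin 2 → ℂ), Module.finrank ℂ P = 1 ∧
      ∀ v ∈ P, (g : Matrix (Fin 2) (Fin 2) ℂ).mulVec v = v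


namespace CoinvariantU2

local notation "S₂" => MvPolynomial (Fin 2) ℂ
local notation "U₂" => Matrix.unitaryGroup (Fin 2) ℂ

lemma eval_actU2 (g : U₂) (v : Fin 2 → ℂ) (f : S₂) :
    eval v (actU2 g f) = eval ((g⁻¹ : U₂).1 *ᵥ v) f := by
  have h : (aeval v : S₂ →ₐ[ℂ] ℂ).comp (actU2 g) = aeval ((g⁻¹ : U₂).1 *ᵥ v) := by
    refine algHom_ext fun i => ?_
    simp only [actU2, AlgHom.comp_apply, aeval_X, map_sum, map_mul, Matrix.mulVec, dotProduct,
      algHom_C, Algebra.algebraMap_self, RingHom.id_apply]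
  simpa using DFunLike.congr_fun h f

lemma actU2_one (f : S₂) : actU2 1 f = f :=
  MvPolynomial.funext fun v => by simp [eval_actU2]

lemma actU2_mul (g h : U₂) (f : S₂) : actU2 (g * h) f = actU2 g (actU2 h f) :=
  MvPolynomial.funext fun v => by
    rw [eval_actU2, eval_actU2, eval_actU2, _root_.mul_inv_rev, Matrix.mulVec_mulVec]
    rfl

lemma actU2_inv_actU2 (g : U₂) (f : S₂) : actU2 g⁻¹ (actU2 g f) = f := by
  rw [← actU2_mul, inv_mul_cancel, actU2_one]

lemma eq_one_of_actU2_X {g : U₂} (h : ∀ i, actU2 g (X i) = X i) : g = 1 := by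
  rw [← inv_eq_one]
  ext i j
  have := congrArg (eval (Pi.single j (1 : ℂ))) (h i)
  rw [eval_actU2, eval_X, eval_X, Matrix.mulVec_single_one] at this
  simpa [Matrix.one_apply, Pi.single_apply] using this

lemma totalDegree_actU2_le (g : U₂) (f : S₂) :
    (actU2 g f).totalDegree ≤ f.totalDegree := by
  conv_lhs => rw [← sum_homogeneousComponent f, map_sum]
  refine (totalDegree_finsetSum _ _).trans (Finset.sup_le fun n hn => ?_)
  have h1 : (actU2 g (homogeneousComponent n f)).IsHomogeneous (1 * n) := by
    refine (homogeneousComponent_isHomogeneous n f).aeval _ fun i => ?_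
    refine IsHomogeneous.sum _ _ _ fun j _ => ?_
    exact isHomogeneous_C_mul_X _ _
  have := h1.totalDegree_le
  have := Finset.mem_range.1 hn
  omega

/-- A reflection has a linear form which divides `f - s f` for every polynomial `f`. -/
lemma exists_linear_dvd_of_isReflectionU2 {s : U₂} (hs : IsReflectionU2 s) :
    ∃ l : S₂, l.totalDegree = 1 ∧ ∀ f, l ∣ f - actU2 s f := by
  obtain ⟨-, -, P, hP, hfix⟩ := hs
  obtain ⟨⟨w, hwP⟩, hw0, -⟩ := finrank_eq_one_iff'.1 hP
  have hw : w ≠ 0 := fun h => hw0 (Subtype.ext h)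
  have hsw : (s⁻¹ : U₂).1 *ᵥ w = w := by
    have h1 := congrArg ((s⁻¹ : U₂).1 *ᵥ ·) (hfix w hwP)
    simp only [Matrix.mulVec_mulVec] at h1
    rw [← Submonoid.coe_mul, inv_mul_cancel] at h1
    simpa using h1.symm
  set l : S₂ := C (w 1) * X 0 - C (w 0) * X 1 with hl
  have hl0 : l ≠ 0 := by
    intro h
    apply hw
    have h0 := congrArg (eval ![1, 0]) h
    have h1 := congrArg (eval ![0, 1]) h
    simp [hl] at h0 h1
    ext i
    fin_cases i <;> simp [h0, h1]
  have hhom : l.IsHomogeneous 1 :=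
    (isHomogeneous_C_mul_X _ _).sub (isHomogeneous_C_mul_X _ _)
  refine ⟨l, hhom.totalDegree hl0, fun f => ?_⟩
  have hX : ∀ i, l ∣ X i - actU2 s (X i) := by
    intro i
    have hrow := congrFun hsw i
    simp only [Matrix.mulVec, dotProduct, Fin.sum_univ_two] at hrow
    obtain ⟨a, b, ha, hb⟩ : ∃ a b : ℂ, X i - actU2 s (X i) = C a * X 0 + C b * X 1 ∧
        a * w 0 + b * w 1 = 0 := by
      fin_cases i
      · refine ⟨1 - (s⁻¹ : U₂).1 0 0, - (s⁻¹ : U₂).1 0 1, ?_, ?_⟩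
        · simp [actU2]; ring
        · simp at hrow ⊢; linear_combination -hrow
      · refine ⟨- (s⁻¹ : U₂).1 1 0, 1 - (s⁻¹ : U₂).1 1 1, ?_, ?_⟩
        · simp [actU2]; ring
        · simp at hrow ⊢; linear_combination -hrow
    rw [ha]
    by_cases h0 : w 0 = 0
    · have h1 : w 1 ≠ 0 := fun h1 => hw (by ext i; fin_cases i <;> simp [h0, h1])
      have hb0 : b = 0 := by simpa [h0, h1] using hb
      refine ⟨C (a / w 1), ?_⟩
      have e : C (w 1) * C (a / w 1) = (C a : S₂) := by rw [← C_mul]; congr 1; field_simp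
      rw [hl, hb0, h0, ← e]; simp; ring
    · refine ⟨C (- b / w 0), ?_⟩
      have e : C (w 0) * C (- b / w 0) = (- C b : S₂) := by
        rw [← C_mul, ← C_neg]; congr 1; field_simp
      have e' : C (w 1) * C (- b / w 0) = (C a : S₂) := by
        rw [← C_mul]; congr 1; field_simp; linear_combination -hb
      rw [hl]; linear_combination (-X 0 : S₂) * e' + X 1 * e
  have hcomp : (Ideal.Quotient.mkₐ ℂ (Ideal.span {l})).comp (actU2 s) =
      Ideal.Quotient.mkₐ ℂ (Ideal.span {l}) := by
    refine algHom_ext fun i => ?_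
    simpa using ((Ideal.Quotient.eq.2 (Ideal.mem_span_singleton.2 (hX i)))).symm
  have := DFunLike.congr_fun hcomp f
  exact Ideal.mem_span_singleton.1 (Ideal.Quotient.eq.1 (by simpa using this.symm))

variable (G : Subgroup (Matrix.unitaryGroup (Fin 2) ℂ))

/-- The subalgebra of `G`-invariant polynomials. -/
noncomputable def invariants : Subalgebra ℂ S₂ where
  carrier := {f | ∀ g ∈ G, actU2 g f = f}
  mul_mem' ha hb g hg := by rw [map_mul, ha g hg, hb g hg]
  add_mem' ha hb g hg := by rw [map_add, ha g hg, hb g hg]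
  algebraMap_mem' r g _ := (actU2 g).commutes r

/-- The ideal generated by the invariants vanishing at the origin. -/
noncomputable def hilbertIdeal : Ideal S₂ :=
  Ideal.span {f | f ∈ invariants G ∧ eval (0 : Fin 2 → ℂ) f = 0}

variable {G}

lemma actU2_mem_hilbertIdeal {g : U₂} (hg : g ∈ G) {f : S₂} (hf : f ∈ hilbertIdeal G) :
    actU2 g f ∈ hilbertIdeal G := by
  have : hilbertIdeal G ≤ (hilbertIdeal G).comap (actU2 g).toRingHom := by
    refine Ideal.span_le.2 fun x hx => ?_
    have hgx : actU2 g x = x := hx.1 g hg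
    change actU2 g x ∈ hilbertIdeal G
    rw [hgx]
    exact Ideal.subset_span hx
  exact this hf

lemma sub_C_eval_mem_hilbertIdeal {f : S₂} (hf : f ∈ invariants G) :
    f - C (eval 0 f) ∈ hilbertIdeal G :=
  Ideal.subset_span ⟨sub_mem hf ((invariants G).algebraMap_mem _), by simp⟩

lemma actU2_sub_mem_hilbertIdeal
    (hrefl : G = Subgroup.closure {g | g ∈ G ∧ IsReflectionU2 g}) {p : S₂}
    (hp : ∀ s ∈ G, IsReflectionU2 s → actU2 s p - p ∈ hilbertIdeal G) {g : U₂} (hg : g ∈ G) :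
    actU2 g p - p ∈ hilbertIdeal G := by
  have hle : Subgroup.closure {g | g ∈ G ∧ IsReflectionU2 g} ≤ G := hrefl.ge
  rw [hrefl] at hg
  induction hg using Subgroup.closure_induction with
  | mem x hx => exact hp x hx.1 hx.2
  | one => simp [actU2_one]
  | mul x y hx hy ihx ihy =>
    have := add_mem (actU2_mem_hilbertIdeal (hle hx) ihy) ihx
    simpa [actU2_mul] using this
  | inv x hx ih =>
    have := neg_mem (actU2_mem_hilbertIdeal (inv_mem (hle hx)) ih)
    simpa [actU2_inv_actU2] using this

lemma finite_over_invariants [Finite G] : Module.Finite (invariants G) S₂ := by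
  let _ : MulSemiringAction G S₂ :=
    { smul := fun g f => actU2 (g : U₂) f
      one_smul := actU2_one
      mul_smul := fun g h f => actU2_mul g h f
      smul_zero := fun g => map_zero _
      smul_add := fun g => map_add _
      smul_one := fun g => map_one _
      smul_mul := fun g => map_mul _ }
  have : Algebra.IsInvariant (invariants G) S₂ G :=
    ⟨fun b hb => ⟨⟨b, fun g hg => hb ⟨g, hg⟩⟩, rfl⟩⟩
  have := Algebra.IsInvariant.isIntegral (invariants G) S₂ G
  have : Algebra.FiniteType (invariants G) S₂ := .of_restrictScalars_finiteType ℂ _ _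
  exact Algebra.IsIntegral.finite

lemma eval_mulVec_of_mem_invariants {f : S₂} (hf : f ∈ invariants G) (g : G) (v : Fin 2 → ℂ) :
    eval ((g : U₂).1 *ᵥ v) f = eval v f := by
  conv_rhs => rw [← hf _ (inv_mem g.2), eval_actU2, inv_inv]

lemma exists_eval_orbit_eq (σ : (S₂ ⧸ hilbertIdeal G) →ₗ[ℂ] S₂) (v : Fin 2 → ℂ) {z : S₂}
    (hz : z ∈ Submodule.span (invariants G) (Set.range σ)) :
    ∃ q, ∀ g : G, eval ((g : U₂).1 *ᵥ v) (σ q) = eval ((g : U₂).1 *ᵥ v) z := by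
  induction hz using Submodule.span_induction with
  | mem x hx =>
    obtain ⟨q, rfl⟩ := hx
    exact ⟨q, fun _ => rfl⟩
  | zero => exact ⟨0, by simp⟩
  | add x y _ _ hx hy =>
    obtain ⟨p, hp⟩ := hx
    obtain ⟨q, hq⟩ := hy
    exact ⟨p + q, fun g => by simp only [map_add, hp, hq]⟩
  | smul a x _ hx =>
    obtain ⟨q, hq⟩ := hx
    refine ⟨eval v (a : S₂) • q, fun g => ?_⟩
    rw [map_smul, smul_eval, hq, Subalgebra.smul_def, smul_eq_mul, map_mul,
      eval_mulVec_of_mem_invariants a.2]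

variable [Fintype G]

/-- The sum of the translates of a polynomial under the group. -/
noncomputable def trace (f : S₂) : S₂ := ∑ g : G, actU2 (g : U₂) f

lemma trace_mem_invariants (f : S₂) : trace (G := G) f ∈ invariants G := by
  intro h hh
  simp only [trace, map_sum, ← actU2_mul]
  exact Fintype.sum_equiv (Equiv.mulLeft (⟨h, hh⟩ : G)) _ _ fun g => rfl

lemma trace_mul {r : S₂} (hr : r ∈ invariants G) (f : S₂) :
    trace (G := G) (r * f) = r * trace (G := G) f := by
  simp only [trace, Finset.mul_sum, map_mul]
  exact Finset.sum_congr rfl fun g _ => by rw [hr g g.2]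

lemma trace_sum {ι : Type*} (s : Finset ι) (f : ι → S₂) :
    trace (G := G) (∑ i ∈ s, f i) = ∑ i ∈ s, trace (G := G) (f i) := by
  simp only [trace, map_sum]
  exact Finset.sum_comm

/-- Chevalley's lemma: if the conductor of `r` into the ideal of invariants generated by the `a i`
is contained in the maximal ideal at the origin, then every `p` with `r * p` in the ideal of
polynomials generated by the `a i` lies in the Hilbert ideal. -/
lemma mem_hilbertIdeal_of_mul_eq_sum
    (hrefl : G = Subgroup.closure {g | g ∈ G ∧ IsReflectionU2 g})
    {ι : Type*} [Fintype ι] {r : S₂} (hr : r ∈ invariants G) {a : ι → S₂}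
    (ha : ∀ i, a i ∈ invariants G)
    (H : ∀ u ∈ invariants G, ∀ t : ι → S₂, (∀ i, t i ∈ invariants G) →
      r * u = ∑ i, a i * t i → eval 0 u = 0)
    (p : S₂) (x : ι → S₂) (hp : r * p = ∑ i, a i * x i) : p ∈ hilbertIdeal G := by
  induction hn : p.totalDegree using Nat.strong_induction_on generalizing p x with
  | _ n ih =>
  have hs : ∀ s ∈ G, IsReflectionU2 s → actU2 s p - p ∈ hilbertIdeal G := by
    intro s hsG hs
    obtain ⟨l, hl1, hl⟩ := exists_linear_dvd_of_isReflectionU2 hs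
    have hl0 : l ≠ 0 := by rintro rfl; simp at hl1
    obtain ⟨h, hh⟩ := hl p
    choose y hy using fun i => hl (x i)
    rw [← neg_sub, hh]
    refine neg_mem (Ideal.mul_mem_left _ _ ?_)
    by_cases h0 : h = 0
    · simp [h0]
    refine ih h.totalDegree ?_ h y ?_ rfl
    · have h1 := totalDegree_mul_of_isDomain hl0 h0
      have h2 := totalDegree_sub p (actU2 s p)
      have h3 := totalDegree_actU2_le s p
      rw [← hh, hl1] at h1
      rw [max_eq_left h3] at h2
      omega
    · apply mul_left_cancel₀ hl0
      have h1 := congrArg (actU2 s) hp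
      simp only [map_mul, map_sum, hr s hsG, ha _ s hsG] at h1
      calc l * (r * h) = r * (p - actU2 s p) := by rw [hh]; ring
        _ = ∑ i, a i * (x i - actU2 s (x i)) := by
          rw [mul_sub, hp, h1, ← Finset.sum_sub_distrib]; simp only [mul_sub]
        _ = l * ∑ i, a i * y i := by
          rw [Finset.mul_sum]
          exact Finset.sum_congr rfl fun i _ => by rw [hy]; ring
  have htr : trace (G := G) p ∈ hilbertIdeal G := by
    refine Ideal.subset_span ⟨trace_mem_invariants p, ?_⟩
    refine H _ (trace_mem_invariants p) (fun i => trace (G := G) (x i))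
      (fun i => trace_mem_invariants _) ?_
    rw [← trace_mul hr, hp, trace_sum]
    exact Finset.sum_congr rfl fun i _ => trace_mul (ha i) _
  have hdiff : trace (G := G) p - C (Fintype.card G : ℂ) * p ∈ hilbertIdeal G := by
    have : trace (G := G) p - C (Fintype.card G : ℂ) * p = ∑ g : G, (actU2 (g : U₂) p - p) := by
      simp [trace, Finset.sum_sub_distrib]
    rw [this]
    exact sum_mem fun g _ => actU2_sub_mem_hilbertIdeal hrefl hs g.2
  have hmul : C (Fintype.card G : ℂ) * p ∈ hilbertIdeal G := by
    simpa using sub_mem htr hdiff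
  have hc : (Fintype.card G : ℂ) ≠ 0 := Nat.cast_ne_zero.2 Fintype.card_ne_zero
  have := Ideal.mul_mem_left _ (C (Fintype.card G : ℂ)⁻¹) hmul
  rwa [← mul_assoc, ← C_mul, inv_mul_cancel₀ hc, C_1, one_mul] at this

/-- Polynomials which are linearly independent modulo the Hilbert ideal are linearly independent
over the invariants. -/
lemma eq_zero_of_sum_mul_eq_zero
    (hrefl : G = Subgroup.closure {g | g ∈ G ∧ IsReflectionU2 g}) {m : ℕ} (e : Fin m → S₂)
    (he : LinearIndependent ℂ fun i => Ideal.Quotient.mk (hilbertIdeal G) (e i))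
    (r : Fin m → S₂) (hr : ∀ i, r i ∈ invariants G) (h : ∑ i, r i * e i = 0) (i : Fin m) :
    r i = 0 := by
  induction m with
  | zero => exact i.elim0
  | succ m ih =>
  rw [Fin.sum_univ_succ] at h
  by_cases H : ∀ u ∈ invariants G, ∀ t : Fin m → S₂, (∀ i, t i ∈ invariants G) →
      r 0 * u = ∑ i : Fin m, r i.succ * t i → eval 0 u = 0
  · have := mem_hilbertIdeal_of_mul_eq_sum hrefl (hr 0) (fun i => hr (Fin.succ i)) H (e 0)
      (fun i => - e i.succ) (by simpa using eq_neg_of_add_eq_zero_left h)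
    exact absurd (Ideal.Quotient.eq_zero_iff_mem.2 this) (he.ne_zero 0)
  · push Not at H
    obtain ⟨u, hu, t, ht, hut, hu0⟩ := H
    have hmk : ∀ f ∈ invariants G, ∀ x : S₂, Ideal.Quotient.mk (hilbertIdeal G) (f * x) =
        eval 0 f • Ideal.Quotient.mk (hilbertIdeal G) x := by
      intro f hf x
      rw [map_mul, Ideal.Quotient.eq.2 (sub_C_eval_mem_hilbertIdeal hf), ← map_mul,
        ← smul_eq_C_mul]
      rfl
    have hsucc : ∀ i : Fin m, r i.succ = 0 := by
      refine ih (fun i => u * e i.succ + t i * e 0) ?_ (fun i => r i.succ) (fun i => hr _) ?_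
      · rw [Fintype.linearIndependent_iff] at he ⊢
        intro c hc i
        have := he (Fin.cons (∑ i, c i * eval 0 (t i)) fun i => c i * eval 0 u) ?_ i.succ
        · rw [Fin.cons_succ] at this
          exact (mul_eq_zero.1 this).resolve_right hu0
        · rw [Fin.sum_univ_succ, ← hc]
          simp only [Fin.cons_zero, Fin.cons_succ, map_add, hmk _ hu, hmk _ (ht _), smul_add,
            Finset.sum_add_distrib, Finset.sum_smul, mul_smul]
          rw [add_comm]
      · have h1 : ∀ i : Fin m, r i.succ * (u * e i.succ + t i * e 0) =
            u * (r i.succ * e i.succ) + r i.succ * t i * e 0 := fun i => by ring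
        simp only [h1, Finset.sum_add_distrib, ← Finset.mul_sum, ← Finset.sum_mul, ← hut]
        linear_combination u * h
    have hu' : u ≠ 0 := by rintro rfl; simp at hu0
    have h0 : r 0 = 0 := by
      simpa [hsucc, hu'] using hut
    exact Fin.cases h0 hsucc i

lemma actU2_ne_zero (g : U₂) {f : S₂} (hf : f ≠ 0) : actU2 g f ≠ 0 := fun h =>
  hf (by rw [← actU2_inv_actU2 g f, h, map_zero])

lemma exists_trace_mul_ne_zero {a : S₂} (ha : a ≠ 0) : ∃ c, trace (G := G) (c * a) ≠ 0 := by
  classical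
  set N : S₂ := ∏ g : G, actU2 (g : U₂) a with hN
  have hNinv : N ∈ invariants G := by
    intro h hh
    simp only [hN, map_prod, ← actU2_mul]
    exact Fintype.prod_equiv (Equiv.mulLeft (⟨h, hh⟩ : G)) _ _ fun g => rfl
  have hN0 : N ≠ 0 := Finset.prod_ne_zero_iff.2 fun g _ => actU2_ne_zero _ ha
  refine ⟨∏ g ∈ Finset.univ.erase (1 : G), actU2 (g : U₂) a, ?_⟩
  have h1 : (∏ g ∈ Finset.univ.erase (1 : G), actU2 (g : U₂) a) * a = N := by
    rw [hN, ← Finset.prod_erase_mul _ _ (Finset.mem_univ (1 : G))]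
    simp [actU2_one]
  have h2 : trace (G := G) N = Fintype.card G * N := by
    have h3 : ∀ g : G, actU2 (g : U₂) N = N := fun g => hNinv _ g.2
    simp [trace, h3]
  rw [h1, h2]
  exact mul_ne_zero (Nat.cast_ne_zero.2 Fintype.card_ne_zero) hN0

/-- Polynomials which are linearly independent over the invariants number at most `|G|`. -/
lemma card_le_of_invariants_linearIndependent {m : ℕ} (e : Fin m → S₂)
    (he : ∀ r : Fin m → S₂, (∀ i, r i ∈ invariants G) → ∑ i, r i * e i = 0 → ∀ i, r i = 0) :
    m ≤ Fintype.card G := by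
  let M : Matrix G (Fin m) S₂ := fun g i => actU2 (g : U₂) (e i)
  suffices Function.Injective M.mulVecLin by
    simpa using card_le_of_injective S₂ M.mulVecLin this
  rw [injective_iff_map_eq_zero]
  intro a ha
  by_contra hne
  obtain ⟨i, hi⟩ := Function.ne_iff.1 hne
  obtain ⟨c, hc⟩ := exists_trace_mul_ne_zero (G := G) hi
  refine hc (he (fun i => trace (G := G) (c * a i)) (fun i => trace_mem_invariants _) ?_ i)
  simp only [trace, Finset.sum_mul]
  rw [Finset.sum_comm]
  refine Finset.sum_eq_zero fun g _ => ?_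
  have h1 : ∑ i, actU2 ((g⁻¹ : G) : U₂) (e i) * a i = 0 := congrFun ha g⁻¹
  have h2 := congrArg (actU2 (g : U₂)) h1
  simp only [map_sum, map_mul, ← actU2_mul, map_zero] at h2
  simp only [InvMemClass.coe_inv, mul_inv_cancel, actU2_one] at h2
  rw [← mul_zero (actU2 (g : U₂) c), ← h2, Finset.mul_sum]
  exact Finset.sum_congr rfl fun i _ => by rw [map_mul]; ring

lemma rank_coinvariants_le (hrefl : G = Subgroup.closure {g | g ∈ G ∧ IsReflectionU2 g}) :
    Module.rank ℂ (S₂ ⧸ hilbertIdeal G) ≤ Fintype.card G := by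
  refine rank_le fun s hs => ?_
  have hs' := hs.comp _ s.equivFin.symm.injective
  choose e he using fun i : Fin s.card =>
    Ideal.Quotient.mk_surjective (I := hilbertIdeal G) (s.equivFin.symm i : S₂ ⧸ hilbertIdeal G)
  refine card_le_of_invariants_linearIndependent e
    (eq_zero_of_sum_mul_eq_zero hrefl e ?_)
  simp only [he]
  exact hs'

lemma exists_equivariant_section
    (ρ : G → (S₂ ⧸ hilbertIdeal G) →ₗ[ℂ] (S₂ ⧸ hilbertIdeal G))
    (hρ : ∀ (g : G) (f : S₂), ρ g (Ideal.Quotient.mk (hilbertIdeal G) f) =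
      Ideal.Quotient.mk (hilbertIdeal G) (actU2 (g : U₂) f)) :
    ∃ σ : (S₂ ⧸ hilbertIdeal G) →ₗ[ℂ] S₂, (∀ q, Ideal.Quotient.mk (hilbertIdeal G) (σ q) = q) ∧
      ∀ (g : G) q, σ (ρ g q) = actU2 (g : U₂) (σ q) := by
  obtain ⟨τ, hτ⟩ := (Ideal.Quotient.mkₐ ℂ (hilbertIdeal G)).toLinearMap
    |>.exists_rightInverse_of_surjective (LinearMap.range_eq_top.2 (Ideal.Quotient.mkₐ_surjective ℂ _))
  have hτ' : ∀ q, Ideal.Quotient.mk (hilbertIdeal G) (τ q) = q := fun q => DFunLike.congr_fun hτ q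
  have hmul : ∀ (g h : G) q, ρ (g * h) q = ρ g (ρ h q) := by
    intro g h q
    obtain ⟨f, rfl⟩ := Ideal.Quotient.mk_surjective q
    simp only [hρ, Subgroup.coe_mul, actU2_mul]
  have hone : ∀ q, ρ 1 q = q := by
    intro q
    obtain ⟨f, rfl⟩ := Ideal.Quotient.mk_surjective q
    simp [hρ, actU2_one]
  have hc : (Fintype.card G : ℂ) ≠ 0 := Nat.cast_ne_zero.2 Fintype.card_ne_zero
  refine ⟨(Fintype.card G : ℂ)⁻¹ • ∑ g : G, (actU2 (g : U₂)).toLinearMap ∘ₗ τ ∘ₗ ρ g⁻¹,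
    fun q => ?_, fun g q => ?_⟩
  · have h1 : ∀ g : G, Ideal.Quotient.mk (hilbertIdeal G) (actU2 (g : U₂) (τ (ρ g⁻¹ q))) = q := by
      intro g
      rw [← hρ, hτ', ← hmul, mul_inv_cancel, hone]
    have h2 : ∀ (c : ℂ) (f : S₂), Ideal.Quotient.mk (hilbertIdeal G) (c • f) =
      c • Ideal.Quotient.mk (hilbertIdeal G) f := fun c f => rfl
    simp only [LinearMap.smul_apply, LinearMap.sum_apply, LinearMap.comp_apply,
      AlgHom.toLinearMap_apply, h2, map_sum, h1, Finset.sum_const, Finset.card_univ]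
    rw [← Nat.cast_smul_eq_nsmul ℂ, smul_smul, inv_mul_cancel₀ hc, one_smul]
  · simp only [LinearMap.smul_apply, LinearMap.sum_apply, LinearMap.comp_apply,
      AlgHom.toLinearMap_apply]
    rw [map_smul, map_sum]
    refine congrArg ((Fintype.card G : ℂ)⁻¹ • ·) ?_
    refine Fintype.sum_equiv (Equiv.mulLeft g⁻¹) _ _ fun h => ?_
    rw [← actU2_mul, ← hmul]
    simp

/-- A form of Nakayama's lemma. -/
lemma exists_smul_mem_of_le_sup_smul {R M : Type*} [CommRing R] [AddCommGroup M] [Module R M]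
    [Module.Finite R M] (I : Ideal R) (N : Submodule R M) (h : ⊤ ≤ N ⊔ I • (⊤ : Submodule R M)) :
    ∃ u : R, u - 1 ∈ I ∧ ∀ x : M, u • x ∈ N := by
  have htop : (⊤ : Submodule R (M ⧸ N)) ≤ I • ⊤ := by
    have h1 := Submodule.map_mono (f := N.mkQ) h
    rwa [Submodule.map_sup, Submodule.map_smul'', Submodule.mkQ_map_self, bot_sup_eq,
      Submodule.map_top, Submodule.range_mkQ] at h1
  obtain ⟨u, hu1, hu⟩ := Submodule.exists_sub_one_mem_and_smul_eq_zero_of_fg_of_le_smul I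
    (⊤ : Submodule R (M ⧸ N)) Module.Finite.fg_top htop
  exact ⟨u, hu1, fun x => (Submodule.Quotient.mk_eq_zero N).1 (hu (N.mkQ x) trivial)⟩

/-- The image of a linear section of `S₂ → S₂ ⧸ hilbertIdeal G` generates `S₂` over the
invariants locally at the origin. -/
lemma exists_mul_mem_span_range (σ : (S₂ ⧸ hilbertIdeal G) →ₗ[ℂ] S₂)
    (hσ : ∀ q, Ideal.Quotient.mk (hilbertIdeal G) (σ q) = q) :
    ∃ u ∈ invariants G, u ≠ 0 ∧
      ∀ f, u * f ∈ Submodule.span (invariants G) (Set.range σ) := by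
  have := finite_over_invariants (G := G)
  set N := Submodule.span (invariants G) (Set.range σ)
  let m : Ideal (invariants G) :=
    RingHom.ker ((eval (0 : Fin 2 → ℂ)).comp (invariants G).val.toRingHom)
  have hJ : ∀ f ∈ hilbertIdeal G, f ∈ m • (⊤ : Submodule (invariants G) S₂) := by
    intro f hf
    induction hf using Submodule.span_induction with
    | mem x hx =>
      have := Submodule.smul_mem_smul (I := m) (N := (⊤ : Submodule (invariants G) S₂))
        (r := ⟨x, hx.1⟩) (n := 1) hx.2 trivial
      simpa [Subalgebra.smul_def] using this
    | zero => exact zero_mem _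
    | add x y _ _ hx hy => exact add_mem hx hy
    | smul a x _ hx =>
      have h : (m • (⊤ : Submodule (invariants G) S₂)) ≤
          (m • (⊤ : Submodule (invariants G) S₂)).comap (LinearMap.mulLeft (invariants G) a) := by
        refine Submodule.smul_le.2 fun r hr n _ => ?_
        rw [Submodule.mem_comap, map_smul]
        exact Submodule.smul_mem_smul hr trivial
      exact h hx
  obtain ⟨u, hu1, hu⟩ := exists_smul_mem_of_le_sup_smul m N fun f _ => by
    have hf : f - σ (Ideal.Quotient.mk _ f) ∈ m • (⊤ : Submodule (invariants G) S₂) :=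
      hJ _ (Ideal.Quotient.eq.1 (hσ _).symm)
    rw [← add_sub_cancel (σ (Ideal.Quotient.mk _ f)) f]
    exact Submodule.add_mem_sup (Submodule.subset_span ⟨_, rfl⟩) hf
  refine ⟨u, u.2, ?_, hu⟩
  intro h
  have h1 : eval (0 : Fin 2 → ℂ) ((u : S₂) - 1) = 0 := hu1
  simp [h] at h1

lemma exists_eval_ne_zero_and_free {u : S₂} (hu : u ≠ 0) :
    ∃ v : Fin 2 → ℂ, eval v u ≠ 0 ∧ ∀ g : G, (g : U₂).1 *ᵥ v = v → g = 1 := by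
  have key : ∀ g : G, ∃ p : S₂, p ≠ 0 ∧
      ∀ v, (g : U₂).1 *ᵥ v = v → eval v p ≠ 0 → g = 1 := by
    intro g
    by_cases hg : g = 1
    · exact ⟨1, one_ne_zero, fun _ _ _ => hg⟩
    · have : ∃ i, actU2 (g : U₂)⁻¹ (X i) ≠ X i := by
        by_contra! h
        exact hg (Subtype.ext (inv_eq_one.1 (eq_one_of_actU2_X h)))
      obtain ⟨i, hi⟩ := this
      refine ⟨_, sub_ne_zero.2 hi, fun v hv h => absurd ?_ h⟩
      rw [map_sub, eval_actU2, inv_inv, hv, sub_self]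
  choose p hp0 hp using key
  have hprod : u * ∏ g, p g ≠ 0 := mul_ne_zero hu (Finset.prod_ne_zero_iff.2 fun g _ => hp0 g)
  obtain ⟨v, hv⟩ : ∃ v, eval v (u * ∏ g, p g) ≠ 0 := by
    by_contra! h
    exact hprod (MvPolynomial.funext fun v => by simpa using h v)
  rw [map_mul, map_prod] at hv
  exact ⟨v, left_ne_zero_of_mul hv, fun g hg => hp g v hg
    (Finset.prod_ne_zero_iff.1 (right_ne_zero_of_mul hv) g (Finset.mem_univ g))⟩

/-- Lagrange interpolation at finitely many points of affine space. -/
lemma exists_eval_eq {ι τ K : Type*} [Field K] [Finite ι] {w : ι → τ → K}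
    (hw : Function.Injective w) (y : ι → K) : ∃ f : MvPolynomial τ K, ∀ i, eval (w i) f = y i := by
  classical
  cases nonempty_fintype ι
  have key : ∀ i j, ∃ d : MvPolynomial τ K, i ≠ j → eval (w i) d = 1 ∧ eval (w j) d = 0 := by
    intro i j
    by_cases hij : i = j
    · exact ⟨0, fun h => absurd hij h⟩
    · obtain ⟨k, hk⟩ := Function.ne_iff.1 (hw.ne hij)
      refine ⟨C (w i k - w j k)⁻¹ * (X k - C (w j k)), fun _ => ⟨?_, ?_⟩⟩
      · simp [inv_mul_cancel₀ (sub_ne_zero.2 hk)]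
      · simp
  choose d hd using key
  refine ⟨∑ i, C (y i) * ∏ j ∈ Finset.univ.erase i, d i j, fun i => ?_⟩
  rw [map_sum, Finset.sum_eq_single i]
  · rw [map_mul, eval_C, map_prod, Finset.prod_eq_one, mul_one]
    intro j hj
    exact (hd i j (Finset.ne_of_mem_erase hj).symm).1
  · intro j _ hj
    rw [map_mul, map_prod, Finset.prod_eq_zero (Finset.mem_erase.2 ⟨hj.symm, Finset.mem_univ i⟩),
      mul_zero]
    exact (hd j i hj).2
  · simp

end CoinvariantU2

open CoinvariantU2

/-- Let `G` be a finite subgroup of U(2) generated by reflections, `J = S𝔪₀` the ideal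
of `S = ℂ[X,Y]` generated by the `G`-invariant polynomials vanishing at `0`, and
`F = S/S𝔪₀` the coinvariant algebra, with the action `ρ` of `G` induced from the action
on `S`.  Then `F` is finite-dimensional and isomorphic, as a representation of `G`,
to the regular representation of `G` (functions on `G` with left translation). -/
theorem coinvariant_algebra_is_regular_rep
    (G : Subgroup (Matrix.unitaryGroup (Fin 2) ℂ)) (hGfin : Finite G)
    (hrefl : G = Subgroup.closure {g | g ∈ G ∧ IsReflectionU2 g})
    (J : Ideal (MvPolynomial (Fin 2) ℂ))
    (hJ : J = Ideal.span {f | (∀ g ∈ G, actU2 g f = f) ∧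
      MvPolynomial.eval (0 : Fin 2 → ℂ) f = 0})
    (ρ : G → (MvPolynomial (Fin 2) ℂ ⧸ J) →ₗ[ℂ] (MvPolynomial (Fin 2) ℂ ⧸ J))
    (hρ : ∀ (g : G) (f : MvPolynomial (Fin 2) ℂ),
      ρ g (Ideal.Quotient.mk J f) = Ideal.Quotient.mk J (actU2 (g : Matrix.unitaryGroup (Fin 2) ℂ) f)) :
    FiniteDimensional ℂ (MvPolynomial (Fin 2) ℂ ⧸ J) ∧
    ∃ Φ : (MvPolynomial (Fin 2) ℂ ⧸ J) ≃ₗ[ℂ] (G → ℂ),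
      ∀ (g : G) (q : MvPolynomial (Fin 2) ℂ ⧸ J) (x : G),
        Φ (ρ g q) x = Φ q (g⁻¹ * x) := by
  obtain rfl : J = hilbertIdeal G := hJ
  cases nonempty_fintype G
  have hrank := rank_coinvariants_le hrefl
  have hfin : FiniteDimensional ℂ (MvPolynomial (Fin 2) ℂ ⧸ hilbertIdeal G) :=
    Module.rank_lt_aleph0_iff.1 (hrank.trans_lt (Cardinal.natCast_lt_aleph0))
  refine ⟨hfin, ?_⟩
  obtain ⟨σ, hσ, hσρ⟩ := exists_equivariant_section ρ hρ
  obtain ⟨u, hu, hu0, hspan⟩ := exists_mul_mem_span_range σ hσ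
  obtain ⟨v, huv, hfree⟩ := exists_eval_ne_zero_and_free (G := G) hu0
  have hinj : Function.Injective fun g : G => (g : Matrix.unitaryGroup (Fin 2) ℂ).1 *ᵥ v := by
    intro g h hgh
    refine (inv_mul_eq_one.1 (hfree (g⁻¹ * h) ?_))
    have h1 : (g : Matrix.unitaryGroup (Fin 2) ℂ).1 *ᵥ v =
      (h : Matrix.unitaryGroup (Fin 2) ℂ).1 *ᵥ v := hgh
    rw [Subgroup.coe_mul, Submonoid.coe_mul, ← Matrix.mulVec_mulVec, ← h1, Matrix.mulVec_mulVec,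
      ← Submonoid.coe_mul, ← Subgroup.coe_mul, inv_mul_cancel]
    simp
  let φ : (MvPolynomial (Fin 2) ℂ ⧸ hilbertIdeal G) →ₗ[ℂ] (G → ℂ) :=
    LinearMap.pi fun g =>
      (aeval ((g : Matrix.unitaryGroup (Fin 2) ℂ).1 *ᵥ v)).toLinearMap ∘ₗ σ
  have hφ : ∀ q g, φ q g = eval ((g : Matrix.unitaryGroup (Fin 2) ℂ).1 *ᵥ v) (σ q) :=
    fun q g => rfl
  have hsurj : Function.Surjective φ := by
    intro y
    obtain ⟨f, hf⟩ := exists_eval_eq hinj fun g => y g / eval v u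
    obtain ⟨q, hq⟩ := exists_eval_orbit_eq σ v (hspan f)
    refine ⟨q, funext fun g => ?_⟩
    rw [hφ, hq, map_mul, eval_mulVec_of_mem_invariants hu, hf, mul_div_cancel₀ _ huv]
  have hdim : Module.finrank ℂ (MvPolynomial (Fin 2) ℂ ⧸ hilbertIdeal G) =
      Module.finrank ℂ (G → ℂ) := by
    refine le_antisymm ?_ (LinearMap.finrank_le_finrank_of_surjective hsurj)
    rw [Module.finrank_fintype_fun_eq_card]
    exact Module.finrank_le_of_rank_le hrank
  refine ⟨LinearEquiv.ofBijective φ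
    ⟨(LinearMap.injective_iff_surjective_of_finrank_eq_finrank hdim).2 hsurj, hsurj⟩,
    fun g q x => ?_⟩
  change φ (ρ g q) x = φ q (g⁻¹ * x)
  rw [hφ, hφ, hσρ, eval_actU2, Matrix.mulVec_mulVec]
  rfl
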